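/- There exist constants C > 1 and c > 0 depending only on n and Λ such that the following holds. Let a > 0 and let Γ ⊂ ℝ^{n+1} be a closed set contained in the cylinder {|x|<1} satisfying property (P) with constant Λ and interval I = [a, Ca]. If D_a ∩ closure(B_r(x₀)) ≠ ∅ for some ball with closure(B_r(x₀)) ⊂ B_{3/4}(0), then |D_{Ca} ∩ B_{r/8}(x₀)| ≥ c rⁿ. -/

import Mathlib

open MeasureTheory Metric Set

noncomputable section

/-- The paraboloid `P_{a,Y}(x) = -(a/2)|x-y|² + y_{n+1}` of opening `-a`, vertex
`Y = (y, y_{n+1})` and center `y`. -/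
def parab (n : ℕ) (a : ℝ) (Y : EuclideanSpace ℝ (Fin n) × ℝ)
    (x : EuclideanSpace ℝ (Fin n)) : ℝ :=
  -(a/2) * ‖x - Y.1‖^2 + Y.2

/-- The graph of `P_{a,Y}` is tangent by below to `Γ` at `Z`. -/
def TangentBelow (n : ℕ) (Γ : Set (EuclideanSpace ℝ (Fin n) × ℝ)) (a : ℝ)
    (Y Z : EuclideanSpace ℝ (Fin n) × ℝ) : Prop :=
  Z ∈ Γ ∧ Z.2 = parab n a Y Z.1 ∧ ∀ X ∈ Γ, parab n a Y X.1 ≤ X.2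

/-- Property (P): near any contact point `Z` (with `|z| ≤ 3/4`) of a tangent-by-below
paraboloid of opening `-a`, `a ∈ I`, centered at some `|y| ≤ 1`, the set `Γ` is the graph of a
`C²` function `v` with `‖D²v(z)‖ ≤ Λ a`. -/
def PropertyP (n : ℕ) (Γ : Set (EuclideanSpace ℝ (Fin n) × ℝ)) (Λ : ℝ) (I : Set ℝ) : Prop :=
  ∀ a ∈ I, ∀ Y Z : EuclideanSpace ℝ (Fin n) × ℝ, ‖Y.1‖ ≤ 1 → ‖Z.1‖ ≤ 3/4 →
    TangentBelow n Γ a Y Z →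
    ∃ r : ℝ, 0 < r ∧ ∃ v : EuclideanSpace ℝ (Fin n) → ℝ, ContDiff ℝ 2 v ∧
      ‖iteratedFDeriv ℝ 2 v Z.1‖ ≤ Λ * a ∧
      Γ ∩ Metric.ball Z r =
        {X : EuclideanSpace ℝ (Fin n) × ℝ | X.2 = v X.1} ∩ Metric.ball Z r

/-- The set `𝒟_a` of contact points appearing in property (P). -/
def contactSet (n : ℕ) (Γ : Set (EuclideanSpace ℝ (Fin n) × ℝ)) (a : ℝ) :
    Set (EuclideanSpace ℝ (Fin n) × ℝ) :=
  {Z | ‖Z.1‖ ≤ 3/4 ∧ ∃ Y : EuclideanSpace ℝ (Fin n) × ℝ, ‖Y.1‖ ≤ 1 ∧ TangentBelow n Γ a Y Z}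

/-- `D_a`: the projection of `𝒟_a` along `e_{n+1}` onto `ℝⁿ`. -/
def contactProj (n : ℕ) (Γ : Set (EuclideanSpace ℝ (Fin n) × ℝ)) (a : ℝ) :
    Set (EuclideanSpace ℝ (Fin n)) :=
  Prod.fst '' contactSet n Γ a

open scoped Topology RealInnerProductSpace Gradient

/-- The second-order necessary condition for a local minimum of a function of one variable. -/
lemma nonneg_of_isLocalMin_of_hasDerivAt {h h' : ℝ → ℝ} {x c : ℝ}
    (hh : ∀ t, HasDerivAt h (h' t) t) (hc : HasDerivAt h' c x) (hmin : IsLocalMin h x) :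
    0 ≤ c := by
  by_contra! hneg
  have hd : deriv h = h' := funext fun t => (hh t).deriv
  have hmax : IsLocalMax h x := by
    refine isLocalMax_of_deriv_deriv_neg ?_ hmin.deriv_eq_zero (hh x).continuousAt
    rwa [hd, hc.deriv]
  have hconst : h =ᶠ[𝓝 x] fun _ => h x := by
    filter_upwards [hmin, hmax] with t h1 h2 using le_antisymm h2 h1
  have h0 : deriv h =ᶠ[𝓝 x] fun _ => 0 := by
    simpa using hconst.deriv
  have h1 := h0.deriv_eq
  rw [hd, hc.deriv] at h1
  simp at h1
  exact hneg.ne h1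

section NormedSpace

variable {E : Type*} [NormedAddCommGroup E] [NormedSpace ℝ E]

lemma norm_fderiv_fderiv_eq (v : E → ℝ) (x : E) :
    ‖fderiv ℝ (fderiv ℝ v) x‖ = ‖iteratedFDeriv ℝ 2 v x‖ := by
  rw [← norm_iteratedFDeriv_one, norm_iteratedFDeriv_fderiv]

/-- If a `C²` function lies above `ψ` along the line through `x` in the unit direction `e`, with
equality at `x`, then the second derivative of `ψ` along that line is at most `‖D²v(x)‖`. -/
lemma le_norm_iteratedFDeriv_two_of_isLocalMin {v : E → ℝ} (hv : ContDiff ℝ 2 v) {x e : E}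
    (he : ‖e‖ = 1) {ψ ψ' : ℝ → ℝ} {c : ℝ} (hψ : ∀ t, HasDerivAt ψ (ψ' t) t)
    (hc : HasDerivAt ψ' c 0) (hmin : IsLocalMin (fun t : ℝ => v (x + t • e) - ψ t) 0) :
    c ≤ ‖iteratedFDeriv ℝ 2 v x‖ := by
  have hline : ∀ t : ℝ, HasDerivAt (fun t : ℝ => x + t • e) e t := fun t => by
    simpa using ((hasDerivAt_id t).smul_const e).const_add x
  have hd : Differentiable ℝ v := hv.differentiable (by norm_num)
  have hdd : Differentiable ℝ (fderiv ℝ v) :=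
    (hv.fderiv_right (m := 1) (by norm_num)).differentiable (by norm_num)
  have h1 : ∀ t : ℝ, HasDerivAt (fun t : ℝ => v (x + t • e) - ψ t)
      (fderiv ℝ v (x + t • e) e - ψ' t) t := fun t =>
    ((hd _).hasFDerivAt.comp_hasDerivAt t (hline t)).sub (hψ t)
  have h2 : HasDerivAt (fun t : ℝ => fderiv ℝ v (x + t • e) e - ψ' t)
      (fderiv ℝ (fderiv ℝ v) x e e - c) 0 := by
    have h3 : HasDerivAt (fun t : ℝ => fderiv ℝ v (x + t • e))
        (fderiv ℝ (fderiv ℝ v) (x + (0 : ℝ) • e) e) 0 :=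
      (hdd _).hasFDerivAt.comp_hasDerivAt 0 (hline 0)
    refine ((h3.clm_apply (hasDerivAt_const (0 : ℝ) e)).sub hc).congr_deriv ?_
    simp
  have h5 := nonneg_of_isLocalMin_of_hasDerivAt h1 h2 hmin
  have h6 : fderiv ℝ (fderiv ℝ v) x e e ≤ ‖fderiv ℝ (fderiv ℝ v) x‖ := by
    refine (le_abs_self _).trans ?_
    simpa [he] using (fderiv ℝ (fderiv ℝ v) x).le_opNorm₂ e e
  rw [norm_fderiv_fderiv_eq] at h6
  linarith

end NormedSpace

/-- The determinant of a linear map of norm at most `K` is at most `K ^ n`. -/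
lemma abs_det_le_pow_of_norm_le {n : ℕ}
    (A : EuclideanSpace ℝ (Fin n) →L[ℝ] EuclideanSpace ℝ (Fin n)) {K : ℝ} (hK : 0 < K)
    (hA : ‖A‖ ≤ K) : |A.det| ≤ K ^ n := by
  have hsub : A '' ball 0 1 ⊆ ball 0 K := by
    rintro _ ⟨x, hx, rfl⟩
    rw [mem_ball_zero_iff] at hx ⊢
    calc ‖A x‖ ≤ K * ‖x‖ := A.le_of_opNorm_le hA x
      _ < K * 1 := by gcongr
      _ = K := mul_one K
  have h := measure_mono (μ := (volume : Measure (EuclideanSpace ℝ (Fin n)))) hsub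
  rw [Measure.addHaar_image_continuousLinearMap, Measure.addHaar_ball_of_pos _ _ hK,
    finrank_euclideanSpace_fin] at h
  have h' := (ENNReal.mul_le_mul_iff_left
    (measure_ball_pos volume (0 : EuclideanSpace ℝ (Fin n)) one_pos).ne' measure_ball_lt_top.ne).1 h
  exact (ENNReal.ofReal_le_ofReal_iff (by positivity)).1 h'

section Paraboloid

variable {n : ℕ}

lemma continuous_parab (a : ℝ) (Y : EuclideanSpace ℝ (Fin n) × ℝ) : Continuous (parab n a Y) := by
  unfold parab
  fun_prop

/-- Subtracting a paraboloid of opening `b` from one of opening `-a` gives one of opening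
`-(a + b)`, centered at the weighted mean of the two centers. -/
lemma exists_parab_sub_eq {a b : ℝ} (hab : a + b ≠ 0) (Y : EuclideanSpace ℝ (Fin n) × ℝ)
    (w : EuclideanSpace ℝ (Fin n)) (k : ℝ) :
    ∃ k' : ℝ, ∀ x, parab n a Y x - b / 2 * ‖x - w‖ ^ 2 + k =
      parab n (a + b) ((a + b)⁻¹ • (a • Y.1 + b • w), k') x := by
  set y := Y.1
  set p := (a + b)⁻¹ • (a • y + b • w) with hp
  refine ⟨Y.2 + k - a / 2 * ‖y‖ ^ 2 - b / 2 * ‖w‖ ^ 2 + (a + b) / 2 * ‖p‖ ^ 2, fun x => ?_⟩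
  have hin : (a + b) * ⟪x, p⟫ = a * ⟪x, y⟫ + b * ⟪x, w⟫ := by
    rw [hp, inner_smul_right, inner_add_right, inner_smul_right, inner_smul_right]
    field_simp
  simp only [parab, norm_sub_sq_real]
  linear_combination -hin

lemma norm_weighted_mean_le {a b R : ℝ} (ha : 0 < a) (hb : 0 ≤ b)
    {y w : EuclideanSpace ℝ (Fin n)} (hy : ‖y‖ ≤ R) (hw : ‖w‖ ≤ R) :
    ‖(a + b)⁻¹ • (a • y + b • w)‖ ≤ R := by
  have hab : 0 < a + b := by linarith
  rw [norm_smul, norm_inv, Real.norm_of_nonneg hab.le, inv_mul_le_iff₀ hab]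
  calc ‖a • y + b • w‖ ≤ ‖a • y‖ + ‖b • w‖ := norm_add_le _ _
    _ = a * ‖y‖ + b * ‖w‖ := by
      rw [norm_smul, norm_smul, Real.norm_of_nonneg ha.le, Real.norm_of_nonneg hb]
    _ ≤ a * R + b * R := by gcongr
    _ = (a + b) * R := by ring

/-- A paraboloid of opening `-a` centered in the unit ball is `2a`-Lipschitz in the unit ball. -/
lemma parab_le_add {a : ℝ} (ha : 0 ≤ a) {Y : EuclideanSpace ℝ (Fin n) × ℝ} (hY : ‖Y.1‖ ≤ 1)
    {x x' : EuclideanSpace ℝ (Fin n)} (hx : ‖x‖ ≤ 1) (hx' : ‖x'‖ ≤ 1) :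
    parab n a Y x ≤ parab n a Y x' + 2 * a * ‖x - x'‖ := by
  have h1 : ‖x' - Y.1‖ ≤ ‖x - Y.1‖ + ‖x - x'‖ := by
    calc ‖x' - Y.1‖ = ‖(x - Y.1) - (x - x')‖ := by congr 1; abel
      _ ≤ _ := norm_sub_le _ _
  have h2 : ‖x - Y.1‖ ≤ 2 := by linarith [norm_sub_le x Y.1]
  have h3 : ‖x' - Y.1‖ ≤ 2 := by linarith [norm_sub_le x' Y.1]
  have h4 : ‖x' - Y.1‖ ^ 2 - ‖x - Y.1‖ ^ 2 ≤ 4 * ‖x - x'‖ := by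
    have h5 := norm_nonneg (x - x')
    have h6 := norm_nonneg (x - Y.1)
    have h7 := norm_nonneg (x' - Y.1)
    nlinarith [mul_nonneg (sub_nonneg.2 h1) (add_nonneg h6 h7),
      mul_nonneg h5 (by linarith : 0 ≤ 4 - (‖x - Y.1‖ + ‖x' - Y.1‖))]
  unfold parab
  linarith [mul_le_mul_of_nonneg_left h4 (by positivity : 0 ≤ a / 2)]

end Paraboloid

section Minimizer

variable {n : ℕ} {Γ : Set (EuclideanSpace ℝ (Fin n) × ℝ)}

/-- A vertical translate of the graph of `f` touches from below any nonempty closed set that lies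
in a bounded cylinder above the graph of a continuous function. -/
lemma exists_sub_le_sub (hΓ : IsClosed Γ) (hcyl : ∀ X ∈ Γ, ‖X.1‖ ≤ 1)
    {f P : EuclideanSpace ℝ (Fin n) → ℝ} (hf : Continuous f) (hP : Continuous P)
    (hbelow : ∀ X ∈ Γ, P X.1 ≤ X.2) (hne : Γ.Nonempty) :
    ∃ Z ∈ Γ, ∀ X ∈ Γ, Z.2 - f Z.1 ≤ X.2 - f X.1 := by
  obtain ⟨Z₀, hZ₀⟩ := hne
  have hcpt := isCompact_closedBall (0 : EuclideanSpace ℝ (Fin n)) 1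
  obtain ⟨A, hA⟩ := (hcpt.bddBelow_image hP.continuousOn)
  obtain ⟨B, hB⟩ := (hcpt.bddAbove_image hf.continuousOn)
  set K := Γ ∩ {X | X.2 - f X.1 ≤ Z₀.2 - f Z₀.1} with hKdef
  have hKc : IsClosed K := hΓ.inter (isClosed_le (by fun_prop) continuous_const)
  have hK : IsCompact K := by
    refine (hcpt.prod (isCompact_Icc (a := A) (b := Z₀.2 - f Z₀.1 + B))).of_isClosed_subset hKc ?_
    rintro X ⟨hX, hX'⟩
    have hX1 : X.1 ∈ closedBall (0 : EuclideanSpace ℝ (Fin n)) 1 :=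
      mem_closedBall_zero_iff.2 (hcyl X hX)
    have h1 := hA (mem_image_of_mem P hX1)
    have h2 := hB (mem_image_of_mem f hX1)
    have h3 := hbelow X hX
    rw [mem_ofPred_eq] at hX'
    exact ⟨hX1, by linarith, by linarith⟩
  obtain ⟨Z, hZ, hmin⟩ := hK.exists_isMinOn ⟨Z₀, hZ₀, by simp⟩
    (f := fun X : EuclideanSpace ℝ (Fin n) × ℝ => X.2 - f X.1) (by fun_prop)
  refine ⟨Z, hZ.1, fun X hX => ?_⟩
  by_cases h : X.2 - f X.1 ≤ Z₀.2 - f Z₀.1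
  · exact hmin ⟨hX, h⟩
  · exact (hZ.2 : Z.2 - f Z.1 ≤ Z₀.2 - f Z₀.1).trans (not_le.1 h).le

end Minimizer

section Contact

variable {n : ℕ} {Γ : Set (EuclideanSpace ℝ (Fin n) × ℝ)}

/-- If `Γ` agrees with the graph of `v` in a ball, then the graph of `v` lies in `Γ` near every
point of that ball. -/
lemma eventually_le_of_graph {Z : EuclideanSpace ℝ (Fin n) × ℝ} {ρ : ℝ}
    {v : EuclideanSpace ℝ (Fin n) → ℝ} (hv : Continuous v)
    (hgraph : Γ ∩ ball Z ρ = {X | X.2 = v X.1} ∩ ball Z ρ) {z : EuclideanSpace ℝ (Fin n)}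
    (hz : (z, v z) ∈ ball Z ρ) : ∀ᶠ x in 𝓝 z, (x, v x) ∈ Γ := by
  have hcont : ContinuousAt (fun x => (x, v x)) z := by fun_prop
  filter_upwards [hcont.eventually_mem (isOpen_ball.mem_nhds hz)] with x hx
  exact (hgraph.symm.subset ⟨rfl, hx⟩).1

lemma eq_of_mem_graph {Z : EuclideanSpace ℝ (Fin n) × ℝ} {ρ : ℝ}
    {v : EuclideanSpace ℝ (Fin n) → ℝ}
    (hgraph : Γ ∩ ball Z ρ = {X | X.2 = v X.1} ∩ ball Z ρ)
    {X : EuclideanSpace ℝ (Fin n) × ℝ} (hX : X ∈ Γ) (hXb : X ∈ ball Z ρ) : X.2 = v X.1 :=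
  (hgraph.subset ⟨hX, hXb⟩).1

lemma hasGradientAt_parab (a : ℝ) (Y : EuclideanSpace ℝ (Fin n) × ℝ)
    (x : EuclideanSpace ℝ (Fin n)) : HasGradientAt (parab n a Y) (-a • (x - Y.1)) x := by
  rw [hasGradientAt_iff_hasFDerivAt]
  have h := (((hasFDerivAt_id x).sub_const Y.1).norm_sq.const_mul (-(a / 2))).add_const Y.2
  refine h.congr_fderiv ?_
  ext w
  simp
  ring

/-- The center of a touching paraboloid is determined by the gradient at the contact point. -/
lemma TangentBelow.center_eq {a : ℝ} (ha : a ≠ 0) {Y X Z : EuclideanSpace ℝ (Fin n) × ℝ} {ρ : ℝ}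
    {v : EuclideanSpace ℝ (Fin n) → ℝ} (hv : Differentiable ℝ v)
    (hgraph : Γ ∩ ball Z ρ = {X | X.2 = v X.1} ∩ ball Z ρ) (hX : X ∈ ball Z ρ)
    (ht : TangentBelow n Γ a Y X) : Y.1 = X.1 + a⁻¹ • ∇ v X.1 := by
  obtain ⟨hXΓ, hX2, hbelow⟩ := ht
  have hXv := eq_of_mem_graph hgraph hXΓ hX
  have hmem : (X.1, v X.1) ∈ ball Z ρ := by rwa [← hXv]
  have hmin : IsLocalMin (fun x => v x - parab n a Y x) X.1 := by
    filter_upwards [eventually_le_of_graph hv.continuous hgraph hmem] with x hx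
    have := hbelow _ hx
    simp only at this
    linarith
  have h1 := hmin.hasFDerivAt_eq_zero
    ((hv X.1).hasFDerivAt.sub (hasGradientAt_parab a Y X.1).hasFDerivAt)
  have h2 : ∇ v X.1 = -a • (X.1 - Y.1) := by
    rw [gradient, sub_eq_zero.1 h1, LinearIsometryEquiv.symm_apply_apply]
  rw [h2, smul_smul]
  simp [ha]

/-- A contact point is at most slightly higher than any nearby point of `Γ`. -/
lemma TangentBelow.snd_le {a : ℝ} (ha : 0 ≤ a) {Y X Z : EuclideanSpace ℝ (Fin n) × ℝ}
    (hY : ‖Y.1‖ ≤ 1) (hX : ‖X.1‖ ≤ 1) (hZ : ‖Z.1‖ ≤ 1) (ht : TangentBelow n Γ a Y X)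
    (hZΓ : Z ∈ Γ) : X.2 ≤ Z.2 + 2 * a * ‖X.1 - Z.1‖ := by
  rw [ht.2.1]
  linarith [parab_le_add ha hY hX hZ, ht.2.2 Z hZΓ]

end Contact

section ContactSet

variable {n : ℕ} {Γ : Set (EuclideanSpace ℝ (Fin n) × ℝ)}

lemma isCompact_contactProj (hΓ : IsClosed Γ) (hcyl : ∀ X ∈ Γ, ‖X.1‖ ≤ 1) {a : ℝ} (ha : 0 ≤ a) :
    IsCompact (contactProj n Γ a) := by
  rcases (contactSet n Γ a).eq_empty_or_nonempty with hempty | ⟨Z₀, -, Y₀, hY₀, ht₀⟩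
  · simp [contactProj, hempty]
  set vertex : EuclideanSpace ℝ (Fin n) × (EuclideanSpace ℝ (Fin n) × ℝ) →
    EuclideanSpace ℝ (Fin n) × ℝ := fun p => (p.1, p.2.2 + a / 2 * ‖p.2.1 - p.1‖ ^ 2) with hvertex
  have hvertex_fst : ∀ p, (vertex p).1 = p.1 := fun _ => rfl
  set K : Set (EuclideanSpace ℝ (Fin n) × (EuclideanSpace ℝ (Fin n) × ℝ)) :=
    {p | ‖p.1‖ ≤ 1} ∩ {p | ‖p.2.1‖ ≤ 3 / 4} ∩ {p | p.2 ∈ Γ} ∩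
      ⋂ X ∈ Γ, {p | parab n a (vertex p) X.1 ≤ X.2} with hK
  have hmem : ∀ p, p ∈ K ↔ ‖p.1‖ ≤ 1 ∧ ‖p.2.1‖ ≤ 3 / 4 ∧ TangentBelow n Γ a (vertex p) p.2 := by
    intro p
    simp only [hK, mem_inter_iff, mem_iInter, mem_ofPred_eq, TangentBelow]
    have : p.2.2 = parab n a (vertex p) p.2.1 := by simp only [parab, hvertex]; ring
    tauto
  have hclosed : IsClosed K := by
    refine ((IsClosed.inter ?_ ?_).inter ?_).inter ?_
    · exact isClosed_le (by fun_prop) continuous_const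
    · exact isClosed_le (by fun_prop) continuous_const
    · exact hΓ.preimage continuous_snd
    · refine isClosed_biInter fun X _ => isClosed_le ?_ continuous_const
      simp only [parab, hvertex]
      fun_prop
  have hcpt : IsCompact K := by
    refine ((isCompact_closedBall (0 : EuclideanSpace ℝ (Fin n)) 1).prod
      ((isCompact_closedBall (0 : EuclideanSpace ℝ (Fin n)) 1).prod
        (isCompact_Icc (a := Z₀.2 - 2 * a * 2) (b := Z₀.2 + 2 * a * 2)))).of_isClosed_subset
          hclosed fun p hp => ?_
    obtain ⟨h1, h2, h3⟩ := (hmem p).1 hp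
    have hZ₀n := hcyl _ ht₀.1
    have hpn := hcyl _ h3.1
    have h4 := TangentBelow.snd_le ha ((congrArg norm (hvertex_fst p)).trans_le h1) hpn hZ₀n h3
      ht₀.1
    have h5 := ht₀.snd_le ha hY₀ hZ₀n hpn h3.1
    have h6 : ‖p.2.1 - Z₀.1‖ ≤ 2 := by linarith [norm_sub_le p.2.1 Z₀.1]
    rw [norm_sub_rev] at h5
    have h7 := mul_le_mul_of_nonneg_left h6 (by positivity : 0 ≤ 2 * a)
    exact ⟨mem_closedBall_zero_iff.2 h1, mem_closedBall_zero_iff.2 hpn, by linarith, by linarith⟩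
  have himage : contactProj n Γ a = (fun p => p.2.1) '' K := by
    ext z
    constructor
    · rintro ⟨Z, ⟨hZ, Y, hY, ht⟩, rfl⟩
      refine ⟨(Y.1, Z), (hmem _).2 ⟨hY, hZ, ?_⟩, rfl⟩
      have : vertex (Y.1, Z) = Y := by
        refine Prod.ext rfl ?_
        have := ht.2.1
        simp only [parab] at this
        simp only [hvertex]
        linarith
      rwa [this]
    · rintro ⟨p, hp, rfl⟩
      obtain ⟨h1, h2, h3⟩ := (hmem p).1 hp
      exact ⟨p.2, ⟨h2, vertex p, h1, h3⟩, rfl⟩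
  rw [himage]
  exact hcpt.image (by fun_prop)

/-- The Riesz isomorphism of Euclidean space, as a real-linear map. -/
def rieszCLM (n : ℕ) :
    StrongDual ℝ (EuclideanSpace ℝ (Fin n)) →L[ℝ] EuclideanSpace ℝ (Fin n) :=
  LinearMap.mkContinuous
    { toFun := (InnerProductSpace.toDual ℝ (EuclideanSpace ℝ (Fin n))).symm
      map_add' := by simp
      map_smul' := by simp } 1 (by simp)

lemma norm_rieszCLM_apply (l : StrongDual ℝ (EuclideanSpace ℝ (Fin n))) :
    ‖rieszCLM n l‖ = ‖l‖ :=
  (InnerProductSpace.toDual ℝ (EuclideanSpace ℝ (Fin n))).symm.norm_map l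

lemma hasFDerivAt_add_smul_gradient {v : EuclideanSpace ℝ (Fin n) → ℝ} (hv : ContDiff ℝ 2 v)
    (c : ℝ) (x : EuclideanSpace ℝ (Fin n)) :
    HasFDerivAt (fun x => x + c • ∇ v x)
      (ContinuousLinearMap.id ℝ _ + c • (rieszCLM n).comp (fderiv ℝ (fderiv ℝ v) x)) x := by
  have hdd : HasFDerivAt (fderiv ℝ v) (fderiv ℝ (fderiv ℝ v) x) x :=
    ((hv.fderiv_right (m := 1) (by norm_num)).differentiable (by norm_num) x).hasFDerivAt
  exact (hasFDerivAt_id x).add (((rieszCLM n).hasFDerivAt.comp x hdd).const_smul c)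

lemma norm_id_add_smul_hessian_le {v : EuclideanSpace ℝ (Fin n) → ℝ}
    {x : EuclideanSpace ℝ (Fin n)} {b Λ : ℝ} (hb : 0 < b)
    (hv : ‖iteratedFDeriv ℝ 2 v x‖ ≤ Λ * b) :
    ‖ContinuousLinearMap.id ℝ (EuclideanSpace ℝ (Fin n)) +
      b⁻¹ • (rieszCLM n).comp (fderiv ℝ (fderiv ℝ v) x)‖ ≤ 1 + Λ := by
  refine (norm_add_le _ _).trans (add_le_add ContinuousLinearMap.norm_id_le ?_)
  rw [norm_smul, norm_inv, Real.norm_of_nonneg hb.le, inv_mul_le_iff₀ hb, mul_comm b]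
  refine le_trans ?_ hv
  rw [← norm_fderiv_fderiv_eq]
  refine ContinuousLinearMap.opNorm_le_bound _ (norm_nonneg (fderiv ℝ (fderiv ℝ v) x)) fun w => ?_
  rw [ContinuousLinearMap.comp_apply, norm_rieszCLM_apply]
  exact (fderiv ℝ (fderiv ℝ v) x).le_opNorm w

/-- If every point of `W` is the center of a touching paraboloid of opening `-b` whose contact
point projects to `s`, then property (P) bounds the volume of `W` by that of `s`. -/
lemma volume_centers_le {Λ b : ℝ} {I : Set ℝ} (hΛ : 0 < Λ) (hb : 0 < b) (hbI : b ∈ I)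
    (hcyl : ∀ X ∈ Γ, ‖X.1‖ ≤ 1) (hP : PropertyP n Γ Λ I) {s W : Set (EuclideanSpace ℝ (Fin n))}
    (hs : MeasurableSet s) (hsub : s ⊆ contactProj n Γ b)
    (hW : ∀ q ∈ W, ∃ Y Z : EuclideanSpace ℝ (Fin n) × ℝ, Y.1 = q ∧ ‖Y.1‖ ≤ 1 ∧ ‖Z.1‖ ≤ 3 / 4 ∧
      TangentBelow n Γ b Y Z ∧ Z.1 ∈ s) :
    volume W ≤ ENNReal.ofReal ((1 + Λ) ^ n) * volume s := by
  have hex : ∀ z ∈ s, ∃ Y Z : EuclideanSpace ℝ (Fin n) × ℝ, Z.1 = z ∧ ‖Y.1‖ ≤ 1 ∧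
      ‖Z.1‖ ≤ 3 / 4 ∧ TangentBelow n Γ b Y Z := fun z hz => by
    obtain ⟨Z, ⟨hZ, Y, hY, ht⟩, rfl⟩ := hsub hz
    exact ⟨Y, Z, rfl, hY, hZ, ht⟩
  choose! Y Z hZ hYn hZn ht using hex
  have hgraph : ∀ z ∈ s, ∃ ρ : ℝ, 0 < ρ ∧ ∃ v : EuclideanSpace ℝ (Fin n) → ℝ, ContDiff ℝ 2 v ∧
      ‖iteratedFDeriv ℝ 2 v z‖ ≤ Λ * b ∧
      Γ ∩ ball (Z z) ρ = {X | X.2 = v X.1} ∩ ball (Z z) ρ := fun z hz => by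
    have := hP b hbI (Y z) (Z z) (hYn z hz) (hZn z hz) (ht z hz)
    rwa [hZ z hz] at this
  choose! ρ hρ v hv hvn hvg using hgraph
  set T : EuclideanSpace ℝ (Fin n) → EuclideanSpace ℝ (Fin n) := fun z => (Y z).1
  have hheight : ∀ z ∈ s, ∀ Y' Z' : EuclideanSpace ℝ (Fin n) × ℝ, ‖Y'.1‖ ≤ 1 →
      TangentBelow n Γ b Y' Z' → dist Z' (Z z) ≤ (1 + 2 * b) * ‖Z'.1 - z‖ := by
    intro z hz Y' Z' hY' ht'
    have h1 := ht'.snd_le hb.le hY' (hcyl _ ht'.1) (hcyl _ (ht z hz).1) (ht z hz).1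
    have h2 := (ht z hz).snd_le hb.le (hYn z hz) (hcyl _ (ht z hz).1) (hcyl _ ht'.1) ht'.1
    rw [norm_sub_rev] at h2
    rw [hZ z hz] at h1 h2
    have h3 := norm_nonneg (Z'.1 - z)
    rw [Prod.dist_eq, hZ z hz, dist_eq_norm, Real.dist_eq]
    refine max_le ?_ (abs_le.2 ⟨?_, ?_⟩) <;> nlinarith
  have hdiff : ∀ z ∈ s, HasFDerivWithinAt T (ContinuousLinearMap.id ℝ _ +
      b⁻¹ • (rieszCLM n).comp (fderiv ℝ (fderiv ℝ (v z)) z)) s z := by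
    intro z hz
    have hd : Differentiable ℝ (v z) := (hv z hz).differentiable (by norm_num)
    have hmodel := hasFDerivAt_add_smul_gradient (hv z hz) b⁻¹ z
    have hnear : ∀ᶠ z' in 𝓝 z, (1 + 2 * b) * ‖z' - z‖ < ρ z := by
      have : Continuous fun z' => (1 + 2 * b) * ‖z' - z‖ := by fun_prop
      exact this.continuousAt.eventually_lt continuousAt_const (by simpa using hρ z hz)
    have heq : ∀ z' ∈ s, (1 + 2 * b) * ‖z' - z‖ < ρ z → T z' = z' + b⁻¹ • ∇ (v z) z' := by
      intro z' hz' hlt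
      have h1 := hheight z hz _ _ (hYn z' hz') (ht z' hz')
      rw [hZ z' hz'] at h1
      have h2 := (ht z' hz').center_eq hb.ne' hd (hvg z hz) (mem_ball.2 (h1.trans_lt hlt))
      rwa [hZ z' hz'] at h2
    refine hmodel.hasFDerivWithinAt.congr_of_eventuallyEq ?_
      (heq z hz (by simpa using hρ z hz))
    filter_upwards [self_mem_nhdsWithin, mem_nhdsWithin_of_mem_nhds hnear] with z' h1 h2
      using heq z' h1 h2
  have hWT : W ⊆ T '' s := by
    intro q hq
    obtain ⟨Y', Z', rfl, hY', -, ht', hZ's⟩ := hW q hq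
    refine ⟨Z'.1, hZ's, ?_⟩
    have hd : Differentiable ℝ (v Z'.1) := (hv _ hZ's).differentiable (by norm_num)
    have h1 := hheight _ hZ's _ _ hY' ht'
    rw [sub_self, norm_zero, mul_zero] at h1
    have h2 := ht'.center_eq hb.ne' hd (hvg _ hZ's) (mem_ball.2 (h1.trans_lt (hρ _ hZ's)))
    have h3 := (ht _ hZ's).center_eq hb.ne' hd (hvg _ hZ's) (mem_ball_self (hρ _ hZ's))
    rw [hZ _ hZ's] at h3
    exact h3.trans h2.symm
  calc volume W ≤ volume (T '' s) := measure_mono hWT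
    _ ≤ ∫⁻ z in s, ENNReal.ofReal |ContinuousLinearMap.det _| :=
      addHaar_image_le_lintegral_abs_det_fderiv volume hs hdiff
    _ ≤ ∫⁻ _ in s, ENNReal.ofReal ((1 + Λ) ^ n) := by
      refine setLIntegral_mono measurable_const fun z hz => ENNReal.ofReal_le_ofReal ?_
      exact abs_det_le_pow_of_norm_le _ (by linarith) (norm_id_add_smul_hessian_le hb (hvn z hz))
    _ = _ := by rw [setLIntegral_const]

end ContactSet

section Barrier

variable {n : ℕ} {Γ : Set (EuclideanSpace ℝ (Fin n) × ℝ)}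

/-- The first two derivatives of the restriction of the barrier to a radial line. -/
lemma hasDerivAt_radial_barrier (A B a r β t₀ : ℝ) (hr : r ≠ 0) :
    (∀ t, HasDerivAt
      (fun t : ℝ => A + B * t - a / 2 * t ^ 2 +
        a * r ^ 2 * Real.exp (β * (1 - (t₀ + t) ^ 2 / r ^ 2)))
      (B - a * t - 2 * a * β * ((t₀ + t) * Real.exp (β * (1 - (t₀ + t) ^ 2 / r ^ 2)))) t) ∧
    HasDerivAt
      (fun t : ℝ => B - a * t - 2 * a * β * ((t₀ + t) * Real.exp (β * (1 - (t₀ + t) ^ 2 / r ^ 2))))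
      (-a + a * Real.exp (β * (1 - t₀ ^ 2 / r ^ 2)) *
        (4 * β ^ 2 * (t₀ ^ 2 / r ^ 2) - 2 * β)) 0 := by
  have hexp : ∀ t : ℝ, HasDerivAt (fun t : ℝ => Real.exp (β * (1 - (t₀ + t) ^ 2 / r ^ 2)))
      (Real.exp (β * (1 - (t₀ + t) ^ 2 / r ^ 2)) * (-(2 * β * (t₀ + t) / r ^ 2))) t := by
    intro t
    have h := ((((((hasDerivAt_id t).const_add t₀).pow 2).div_const (r ^ 2)).const_sub 1).const_mul
      β).exp
    refine h.congr_deriv ?_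
    simp
    ring
  constructor
  · intro t
    have h := ((((hasDerivAt_id t).const_mul B).const_add A).sub
      (((hasDerivAt_id t).pow 2).const_mul (a / 2))).add ((hexp t).const_mul (a * r ^ 2))
    refine h.congr_deriv ?_
    simp
    field_simp
    ring_nf
  · have h := (((hasDerivAt_id (0 : ℝ)).const_mul a).const_sub B).sub
      ((((hasDerivAt_id (0 : ℝ)).const_add t₀).mul (hexp 0)).const_mul (2 * a * β))
    refine h.congr_deriv ?_
    simp
    ring

/-- The paraboloid `P_{a,Y}` raised by a radial bump that vanishes on the sphere of radius `r`
about `x₀`. -/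
def barrier (n : ℕ) (a r β : ℝ) (Y : EuclideanSpace ℝ (Fin n) × ℝ)
    (x₀ x : EuclideanSpace ℝ (Fin n)) : ℝ :=
  parab n a Y x + a * r ^ 2 * (Real.exp (β * (1 - ‖x - x₀‖ ^ 2 / r ^ 2)) - 1)

lemma continuous_barrier (a r β : ℝ) (Y : EuclideanSpace ℝ (Fin n) × ℝ)
    (x₀ : EuclideanSpace ℝ (Fin n)) : Continuous (barrier n a r β Y x₀) := by
  have := continuous_parab a Y
  unfold barrier
  fun_prop

lemma barrier_add_smul (a r β : ℝ) (Y : EuclideanSpace ℝ (Fin n) × ℝ)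
    {x₀ x e : EuclideanSpace ℝ (Fin n)} {t₀ : ℝ} (he : ‖e‖ = 1) (hx : x - x₀ = t₀ • e) (t : ℝ) :
    barrier n a r β Y x₀ (x + t • e) = (parab n a Y x - a * r ^ 2) +
      (-a * ⟪x - Y.1, e⟫) * t - a / 2 * t ^ 2 +
        a * r ^ 2 * Real.exp (β * (1 - (t₀ + t) ^ 2 / r ^ 2)) := by
  have h1 : ‖x + t • e - x₀‖ ^ 2 = (t₀ + t) ^ 2 := by
    rw [add_sub_right_comm, hx, ← add_smul, norm_smul, he, mul_one, Real.norm_eq_abs, sq_abs]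
  have h2 : ‖x + t • e - Y.1‖ ^ 2 = ‖x - Y.1‖ ^ 2 + 2 * (t * ⟪x - Y.1, e⟫) + t ^ 2 := by
    rw [add_sub_right_comm, norm_add_sq_real, inner_smul_right, norm_smul, he, mul_one,
      Real.norm_eq_abs, sq_abs]
  simp only [barrier, parab, h1, h2]
  ring

/-- A contact point with the barrier is also a contact point with a paraboloid. -/
lemma exists_tangentBelow_of_barrier {a r β : ℝ} (ha : 0 < a) (hr : 0 < r) (hβ : 0 < β)
    {x₀ : EuclideanSpace ℝ (Fin n)} (hx₀ : ‖x₀‖ ≤ 1)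
    {Y X : EuclideanSpace ℝ (Fin n) × ℝ} (hY : ‖Y.1‖ ≤ 1) (hX : X ∈ Γ)
    (hmin : ∀ W ∈ Γ, X.2 - barrier n a r β Y x₀ X.1 ≤ W.2 - barrier n a r β Y x₀ W.1)
    {b : ℝ} (hb : b = 2 * a * β * Real.exp (β * (1 - ‖X.1 - x₀‖ ^ 2 / r ^ 2))) :
    ∃ Y' : EuclideanSpace ℝ (Fin n) × ℝ, ‖Y'.1‖ ≤ 1 ∧ TangentBelow n Γ (a + b) Y' X := by
  have har : 0 < a * r ^ 2 := by positivity
  have hb0 : 0 < b := by rw [hb]; positivity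
  generalize hs : ‖X.1 - x₀‖ ^ 2 / r ^ 2 = s at hb
  generalize hE : Real.exp (β * (1 - s)) = E at hb
  have hE0 : 0 < E := hE ▸ Real.exp_pos _
  have hbr : ∀ t : ℝ, b / 2 * t = a * r ^ 2 * (E * (β * (t / r ^ 2))) := fun t => by
    rw [hb]
    field_simp
  obtain ⟨k, hk⟩ := exists_parab_sub_eq (a := a) (b := b) (by positivity) Y x₀
    (a * r ^ 2 * (E * (1 + β * s) - 1) + (X.2 - barrier n a r β Y x₀ X.1))
  refine ⟨((a + b)⁻¹ • (a • Y.1 + b • x₀), k), norm_weighted_mean_le ha hb0.le hY hx₀, hX, ?_,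
    fun W hW => ?_⟩
  · rw [← hk, hbr, hs, barrier, hs, hE]
    ring
  · rw [← hk, hbr]
    have h1 := hmin W hW
    rw [barrier] at h1
    rw [barrier] at h1 ⊢
    generalize ‖W.1 - x₀‖ ^ 2 / r ^ 2 = s' at h1 ⊢
    have h2 : E * (1 + β * (s - s')) ≤ Real.exp (β * (1 - s')) := by
      have h3 := Real.add_one_le_exp (β * (s - s'))
      calc E * (1 + β * (s - s')) ≤ E * Real.exp (β * (s - s')) := by gcongr; linarith
        _ = Real.exp (β * (1 - s')) := by
          rw [← hE, ← Real.exp_add]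
          congr 1
          ring
    have h4 := mul_le_mul_of_nonneg_left h2 har.le
    linarith

/-- Property (P) prevents the barrier from touching `Γ` from below in the annulus where its radial
second derivative is large. -/
lemma not_barrier_touches {Λ a r β C : ℝ} (hΛ : 0 < Λ) (ha : 0 < a) (hr : 0 < r)
    (hβ : β = 256 * (1 + Λ)) (hC : 1 + 2 * β * Real.exp β ≤ C)
    (hP : PropertyP n Γ Λ (Icc a (C * a)))
    {x₀ : EuclideanSpace ℝ (Fin n)} (hx₀ : ‖x₀‖ ≤ 1)
    {Y X : EuclideanSpace ℝ (Fin n) × ℝ} (hY : ‖Y.1‖ ≤ 1) (hX : X ∈ Γ) (hXn : ‖X.1‖ ≤ 3 / 4)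
    (hfar : r / 16 < ‖X.1 - x₀‖) (hXr : ‖X.1 - x₀‖ ≤ r) :
    ¬ ∀ W ∈ Γ, X.2 - barrier n a r β Y x₀ X.1 ≤ W.2 - barrier n a r β Y x₀ W.1 := by
  intro hmin
  have hβ0 : 0 < β := by rw [hβ]; positivity
  obtain ⟨b, hb⟩ : ∃ b, b = 2 * a * β * Real.exp (β * (1 - ‖X.1 - x₀‖ ^ 2 / r ^ 2)) := ⟨_, rfl⟩
  obtain ⟨Y', hY', htan⟩ := exists_tangentBelow_of_barrier ha hr hβ0 hx₀ hY hX hmin hb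
  obtain ⟨t₀, ht₀⟩ : ∃ t₀, t₀ = ‖X.1 - x₀‖ := ⟨_, rfl⟩
  rw [← ht₀] at hfar hXr hb
  have ht₀pos : 0 < t₀ := by linarith
  obtain ⟨s, hs⟩ : ∃ s, s = t₀ ^ 2 / r ^ 2 := ⟨_, rfl⟩
  obtain ⟨E, hE⟩ : ∃ E, E = Real.exp (β * (1 - s)) := ⟨_, rfl⟩
  have hs1 : s ≤ 1 := by
    rw [hs, div_le_one (by positivity)]
    gcongr
  have hs2 : 1 / 256 ≤ s := by
    rw [hs, div_le_div_iff₀ (by norm_num) (by positivity)]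
    nlinarith
  rw [← hs, ← hE] at hb
  have hE1 : 1 ≤ E := hE ▸ Real.one_le_exp (mul_nonneg hβ0.le (sub_nonneg.2 hs1))
  have hEβ : E ≤ Real.exp β :=
    hE ▸ Real.exp_le_exp.2 (mul_le_of_le_one_right hβ0.le (by linarith))
  have hb0 : 0 ≤ b := by rw [hb]; positivity
  have hmemI : a + b ∈ Icc a (C * a) := by
    refine ⟨by linarith, ?_⟩
    calc a + b = (1 + 2 * β * E) * a := by rw [hb]; ring
      _ ≤ (1 + 2 * β * Real.exp β) * a := by gcongr
      _ ≤ C * a := by gcongr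
  obtain ⟨ρ, hρ, v, hv, hvn, hvg⟩ := hP (a + b) hmemI Y' X hY' hXn htan
  have hXv := eq_of_mem_graph hvg hX (mem_ball_self hρ)
  obtain ⟨e, he⟩ : ∃ e, e = t₀⁻¹ • (X.1 - x₀) := ⟨_, rfl⟩
  have hen : ‖e‖ = 1 := by
    rw [he, norm_smul, norm_inv, Real.norm_of_nonneg ht₀pos.le, ← ht₀,
      inv_mul_cancel₀ ht₀pos.ne']
  have hXe : X.1 - x₀ = t₀ • e := by rw [he, smul_smul, mul_inv_cancel₀ ht₀pos.ne', one_smul]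
  have hline := barrier_add_smul a r β Y hen hXe
  obtain ⟨hd1, hd2⟩ := hasDerivAt_radial_barrier (parab n a Y X.1 - a * r ^ 2)
    (-a * ⟪X.1 - Y.1, e⟫) a r β t₀ hr.ne'
  simp only [← hline] at hd1
  have hlocal : IsLocalMin (fun t : ℝ => v (X.1 + t • e) -
      barrier n a r β Y x₀ (X.1 + t • e)) 0 := by
    have hcont : Filter.Tendsto (fun t : ℝ => X.1 + t • e) (𝓝 0) (𝓝 X.1) := by
      have : Continuous fun t : ℝ => X.1 + t • e := by fun_prop
      simpa using this.tendsto 0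
    have hmem : (X.1, v X.1) ∈ ball X ρ := by
      rw [← hXv]
      exact mem_ball_self hρ
    filter_upwards [hcont.eventually (eventually_le_of_graph hv.continuous hvg hmem)] with t h
    have := hmin _ h
    rw [zero_smul, add_zero, ← hXv]
    exact this
  have hle := (le_norm_iteratedFDeriv_two_of_isLocalMin hv hen hd1 hd2 hlocal).trans hvn
  rw [← hs, ← hE, hb] at hle
  have hquad : 2 * β * (1 + Λ) ≤ 4 * β ^ 2 * s - 2 * β - 2 * β * Λ := by
    have h1 := mul_le_mul_of_nonneg_left hs2 (by positivity : 0 ≤ 4 * β ^ 2)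
    have h2 : β ^ 2 = 256 * (1 + Λ) * β := by rw [← hβ, sq]
    linarith
  have hbig : a * (1 + Λ) < a * (E * (2 * β * (1 + Λ))) := by
    have h1 : 1 < 2 * β := by rw [hβ]; linarith
    have h2 : 1 < E * (2 * β) := one_lt_mul_of_le_of_lt hE1 h1
    have h3 := mul_lt_mul_of_pos_left
      (mul_lt_mul_of_pos_right h2 (by linarith : 0 < 1 + Λ)) ha
    linarith
  have hcontra := mul_le_mul_of_nonneg_left hquad (by positivity : 0 ≤ a * E)
  linarith

/-- A contact point in a ball forces `Γ` to be close to the touching paraboloid somewhere in the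
concentric ball of one sixteenth of the radius. -/
lemma exists_le_parab_add {Λ a r β C : ℝ} (hΛ : 0 < Λ) (ha : 0 < a) (hr : 0 < r)
    (hβ : β = 256 * (1 + Λ)) (hC : 1 + 2 * β * Real.exp β ≤ C) (hΓ : IsClosed Γ)
    (hcyl : ∀ X ∈ Γ, ‖X.1‖ ≤ 1) (hP : PropertyP n Γ Λ (Icc a (C * a)))
    {x₀ : EuclideanSpace ℝ (Fin n)} (hball : closedBall x₀ r ⊆ ball 0 (3 / 4))
    {Y Z : EuclideanSpace ℝ (Fin n) × ℝ} (hY : ‖Y.1‖ ≤ 1) (hZ : Z.1 ∈ closedBall x₀ r)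
    (ht : TangentBelow n Γ a Y Z) :
    ∃ X ∈ Γ, ‖X.1 - x₀‖ ≤ r / 16 ∧ X.2 ≤ parab n a Y X.1 + a * r ^ 2 * Real.exp β := by
  have hβ0 : 0 < β := by rw [hβ]; positivity
  have har : 0 < a * r ^ 2 := by positivity
  have hge : ∀ x, ‖x - x₀‖ ≤ r → parab n a Y x ≤ barrier n a r β Y x₀ x := fun x hx => by
    refine le_add_of_nonneg_right (mul_nonneg har.le (sub_nonneg.2 (Real.one_le_exp
      (mul_nonneg hβ0.le (sub_nonneg.2 ?_)))))
    rw [div_le_one (by positivity)]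
    gcongr
  have hle : ∀ x, r ≤ ‖x - x₀‖ → barrier n a r β Y x₀ x ≤ parab n a Y x := fun x hx => by
    refine add_le_of_nonpos_right (mul_nonpos_of_nonneg_of_nonpos har.le (sub_nonpos.2
      (Real.exp_le_one_iff.2 (mul_nonpos_of_nonneg_of_nonpos hβ0.le (sub_nonpos.2 ?_)))))
    rw [one_le_div (by positivity)]
    gcongr
  have hexp : ∀ x, barrier n a r β Y x₀ x ≤ parab n a Y x + a * r ^ 2 * Real.exp β := fun x => by
    have h1 : 0 ≤ ‖x - x₀‖ ^ 2 / r ^ 2 := by positivity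
    have h2 : Real.exp (β * (1 - ‖x - x₀‖ ^ 2 / r ^ 2)) ≤ Real.exp β :=
      Real.exp_le_exp.2 (mul_le_of_le_one_right hβ0.le (by linarith))
    unfold barrier
    gcongr
    linarith
  have hZr : ‖Z.1 - x₀‖ ≤ r := mem_closedBall_iff_norm.1 hZ
  obtain ⟨X, ⟨hXΓ, hXr⟩, hmin⟩ := exists_sub_le_sub
    (Γ := Γ ∩ {X | ‖X.1 - x₀‖ ≤ r}) (hΓ.inter (isClosed_le (by fun_prop) continuous_const))
    (fun X hX => hcyl X hX.1) (continuous_barrier a r β Y x₀) (continuous_parab a Y)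
    (fun X hX => ht.2.2 X hX.1) ⟨Z, ht.1, hZr⟩
  rw [mem_ofPred_eq] at hXr
  have hm : X.2 - barrier n a r β Y x₀ X.1 ≤ 0 := by
    refine (hmin Z ⟨ht.1, hZr⟩).trans ?_
    rw [ht.2.1]
    exact sub_nonpos.2 (hge _ hZr)
  have hglob : ∀ W ∈ Γ, X.2 - barrier n a r β Y x₀ X.1 ≤ W.2 - barrier n a r β Y x₀ W.1 :=
    fun W hW => by
      rcases le_total ‖W.1 - x₀‖ r with h | h
      · exact hmin W ⟨hW, h⟩
      · linarith [hle _ h, ht.2.2 W hW]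
  refine ⟨X, hXΓ, ?_, by linarith [hexp X.1]⟩
  by_contra! hfar
  have hx₀ := mem_ball_zero_iff.1 (hball (mem_closedBall_self hr.le))
  have hXn := mem_ball_zero_iff.1 (hball (mem_closedBall_iff_norm.2 hXr))
  exact not_barrier_touches hΛ ha hr hβ hC hP (by linarith) hY hXΓ hXn.le hfar hXr hglob

end Barrier

/-- Lemma 6.6: there exist universal `C > 1`, `c > 0` such that if `Γ` has
property (P) with `I = [a, Ca]` and `D_a` meets `closure B_r(x₀) ⊂ B_{3/4}`, then
`|D_{Ca} ∩ B_{r/8}(x₀)| ≥ c rⁿ`. -/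
theorem contact_set_measure_expansion
    (n : ℕ) (Λ : ℝ) (hΛ : 0 < Λ) :
    ∃ C : ℝ, 1 < C ∧ ∃ c : ℝ, 0 < c ∧
      ∀ a : ℝ, 0 < a →
      ∀ Γ : Set (EuclideanSpace ℝ (Fin n) × ℝ), IsClosed Γ →
        Γ ⊆ {X | ‖X.1‖ < 1} →
        PropertyP n Γ Λ (Set.Icc a (C * a)) →
      ∀ (x₀ : EuclideanSpace ℝ (Fin n)) (r : ℝ), 0 < r →
        closure (Metric.ball x₀ r) ⊆ Metric.ball (0 : EuclideanSpace ℝ (Fin n)) (3/4) →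
        (contactProj n Γ a ∩ closure (Metric.ball x₀ r)).Nonempty →
        ENNReal.ofReal (c * r ^ n) ≤
          volume (contactProj n Γ (C * a) ∩ Metric.ball x₀ (r / 8)) := by
  set β : ℝ := 256 * (1 + Λ) with hβ
  have hβ0 : 0 < β := by positivity
  set C₁ : ℝ := 4096 * β * Real.exp β with hC₁
  have hC₁0 : 0 < C₁ := by positivity
  have hβ1 : 1 ≤ β := by rw [hβ]; linarith
  set δ : ℝ := C₁ / (1 + C₁) / 64 with hδ
  have hδ0 : 0 < δ := by positivity
  set ω : ℝ := (volume (ball (0 : EuclideanSpace ℝ (Fin n)) 1)).toReal with hω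
  have hω0 : 0 < ω := ENNReal.toReal_pos (measure_ball_pos _ _ one_pos).ne' measure_ball_lt_top.ne
  refine ⟨1 + C₁, by linarith, δ ^ n * ω / (1 + Λ) ^ n, by positivity, ?_⟩
  intro a ha Γ hΓ hΓcyl hP x₀ r hr hball hne
  have hcyl : ∀ X ∈ Γ, ‖X.1‖ ≤ 1 := fun X hX => (show ‖X.1‖ < 1 from hΓcyl hX).le
  obtain ⟨_, ⟨Z, ⟨-, Y, hY, ht⟩, rfl⟩, hZr⟩ := hne
  rw [closure_ball x₀ hr.ne'] at hball hZr
  have hβexp : 0 < β * Real.exp β := by positivity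
  obtain ⟨X, hXΓ, hXr, hXh⟩ := exists_le_parab_add hΛ ha hr hβ
    (by rw [hC₁]; linarith : 1 + 2 * β * Real.exp β ≤ 1 + C₁) hΓ hcyl hP hball hY hZr ht
  have hb : (1 + C₁) * a = a + C₁ * a := by ring
  have hCa : 0 < C₁ * a := by positivity
  set b := (1 + C₁) * a with hbdef
  have hb0 : 0 < b := by positivity
  set s := contactProj n Γ b ∩ ball x₀ (r / 8) with hs
  set w := b⁻¹ • (a • Y.1 + (C₁ * a) • X.1) with hw
  have hcenters : ∀ q ∈ ball w (δ * r), ∃ Y' Z' : EuclideanSpace ℝ (Fin n) × ℝ, Y'.1 = q ∧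
      ‖Y'.1‖ ≤ 1 ∧ ‖Z'.1‖ ≤ 3 / 4 ∧ TangentBelow n Γ b Y' Z' ∧ Z'.1 ∈ s := by
    intro q hq
    set y := X.1 + ((1 + C₁) / C₁) • (q - w) with hy
    have hqy : q = b⁻¹ • (a • Y.1 + (C₁ * a) • y) := by
      have h1 : b⁻¹ * (C₁ * a) * ((1 + C₁) / C₁) = 1 := by rw [hbdef]; field_simp
      rw [hy, smul_add (C₁ * a), ← add_assoc, smul_add b⁻¹ (_ + _), ← hw, smul_smul, smul_smul,
        h1, one_smul]
      abel
    have hyX : ‖y - X.1‖ ≤ r / 64 := by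
      rw [mem_ball_iff_norm] at hq
      rw [hy, add_sub_cancel_left, norm_smul, Real.norm_of_nonneg (by positivity)]
      calc (1 + C₁) / C₁ * ‖q - w‖ ≤ (1 + C₁) / C₁ * (δ * r) := by gcongr
        _ = r / 64 := by rw [hδ]; field_simp
    have hyn : ‖y‖ ≤ 1 := by
      have h1 : y ∈ closedBall x₀ r := by
        rw [mem_closedBall_iff_norm]
        have := norm_sub_le_norm_sub_add_norm_sub y X.1 x₀
        linarith
      have := mem_ball_zero_iff.1 (hball h1)
      linarith
    obtain ⟨Z', hZ'Γ, hmin⟩ := exists_sub_le_sub hΓ hcyl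
      (f := fun x => parab n a Y x - C₁ * a / 2 * ‖x - y‖ ^ 2)
      (by have := continuous_parab a Y; fun_prop) (continuous_parab a Y) ht.2.2 ⟨X, hXΓ⟩
    obtain ⟨k', hk'⟩ := exists_parab_sub_eq (a := a) (b := C₁ * a) (by positivity) Y y
      (Z'.2 - (parab n a Y Z'.1 - C₁ * a / 2 * ‖Z'.1 - y‖ ^ 2))
    rw [← hb, ← hqy] at hk'
    have hZ'y : ‖Z'.1 - y‖ ≤ r / 32 := by
      have h1 := hmin X hXΓ
      have h2 := ht.2.2 Z' hZ'Γ
      rw [norm_sub_rev] at hyX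
      have h3 : ‖X.1 - y‖ ^ 2 ≤ (r / 64) ^ 2 := by gcongr
      have h4 : C₁ * a / 2 * ‖Z'.1 - y‖ ^ 2 ≤
          a * r ^ 2 * Real.exp β + C₁ * a / 2 * (r / 64) ^ 2 := by
        have := mul_le_mul_of_nonneg_left h3 (by positivity : 0 ≤ C₁ * a / 2)
        linarith
      have h5 : a * r ^ 2 * Real.exp β ≤ C₁ * a / 2 * (r ^ 2 / 2048) := by
        have : a * r ^ 2 * Real.exp β * 1 ≤ a * r ^ 2 * Real.exp β * β := by gcongr
        rw [hC₁]
        linarith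
      have h6 : ‖Z'.1 - y‖ ^ 2 ≤ (r / 32) ^ 2 := by
        have h7 : C₁ * a / 2 * ‖Z'.1 - y‖ ^ 2 ≤ C₁ * a / 2 * (r / 32) ^ 2 := by
          have : 0 < C₁ * a / 2 * r ^ 2 := by positivity
          linarith
        exact le_of_mul_le_mul_left h7 (by positivity)
      exact (sq_le_sq₀ (norm_nonneg _) (by positivity)).1 h6
    have hZ'x : ‖Z'.1 - x₀‖ < r / 8 := by
      have h1 := norm_sub_le_norm_sub_add_norm_sub Z'.1 y x₀
      have h2 := norm_sub_le_norm_sub_add_norm_sub y X.1 x₀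
      linarith
    have hZ'n : ‖Z'.1‖ ≤ 3 / 4 := by
      have : Z'.1 ∈ closedBall x₀ r := mem_closedBall_iff_norm.2 (by linarith)
      exact (mem_ball_zero_iff.1 (hball this)).le
    have hqn : ‖q‖ ≤ 1 := by
      rw [hqy, hb]
      exact norm_weighted_mean_le ha hCa.le hY hyn
    have htan : TangentBelow n Γ b (q, k') Z' := by
      refine ⟨hZ'Γ, ?_, fun W hW => ?_⟩
      · rw [← hk']
        ring
      · rw [← hk']
        have := hmin W hW
        linarith
    exact ⟨(q, k'), Z', rfl, hqn, hZ'n, htan, ⟨Z', ⟨hZ'n, (q, k'), hqn, htan⟩, rfl⟩,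
      mem_ball_iff_norm.2 hZ'x⟩
  have hmeas : MeasurableSet s :=
    (isCompact_contactProj hΓ hcyl hb0.le).isClosed.measurableSet.inter measurableSet_ball
  have hvol := volume_centers_le hΛ hb0 (⟨by linarith, le_rfl⟩ : b ∈ Icc a b) hcyl hP hmeas
    inter_subset_left hcenters
  rw [Measure.addHaar_ball_of_pos _ _ (by positivity), finrank_euclideanSpace_fin,
    ← ENNReal.ofReal_toReal (measure_ball_lt_top (μ := volume)
      (x := (0 : EuclideanSpace ℝ (Fin n))) (r := 1)).ne, ← hω,
    ← ENNReal.ofReal_mul (by positivity)] at hvol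
  have hK : 0 < (1 + Λ) ^ n := by positivity
  rw [← ENNReal.mul_le_mul_iff_right (ENNReal.ofReal_pos.2 hK).ne' ENNReal.ofReal_ne_top,
    ← ENNReal.ofReal_mul hK.le]
  refine le_of_eq_of_le (congrArg ENNReal.ofReal ?_) hvol
  field_simp
  exact (mul_pow δ r n).symm

end
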